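/- Let V be a nonempty finite set and let (·,·) be a negative definite symmetric ℤ-valued bilinear form on L := ℤ^V with standard basis {E_v}_{v∈V}, with (E_u,E_v) ∈ {0,1} for all u ≠ v; let the dual graph G (edge between u ≠ v iff (E_u,E_v) = 1) be a tree; let Z_K ∈ ℚ^V be the unique vector with (Z_K,E_v) = (E_v,E_v)+2 for all v, and χ(x) := −(x, x−Z_K)/2. Fix l' with (l',E_v) a nonnegative integer for every v, and a cycle Z ∈ L with all coordinates ≥ 1. Then t(Z,l') = max_{0≤Z₁≤Z} ( −(l',Z₁) − χ(Z₁) + χ(E_{|Z₁|}) ), where E_{|Z₁|} := Σ_{v∈|Z₁|} E_v and the term for Z₁ = 0 equals 0. -/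

import Mathlib

open Classical

noncomputable section

/-- The rational pairing on `ℚ^V` determined by the integral matrix `M`. -/
def pairQ {V : Type} [Fintype V] (M : Matrix V V ℤ) (x y : V → ℚ) : ℚ :=
  ∑ u, ∑ v, x u * (M u v : ℚ) * y v

/-- The Riemann–Roch expression `χ(x) = −(x, x − Z_K)/2`. -/
def chiQ {V : Type} [Fintype V] (M : Matrix V V ℤ) (ZK : V → ℚ) (x : V → ℚ) : ℚ :=
  - pairQ M x (x - ZK) / 2

/-- Inclusion of integral cycles into `ℚ^V`. -/
def toQ {V : Type} (l : V → ℤ) : V → ℚ := fun v => (l v : ℚ)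

/-- The dual graph: `u ~ v` iff `u ≠ v` and `M u v > 0` (for symmetric `M`). -/
def dualGraph {V : Type} (M : Matrix V V ℤ) : SimpleGraph V :=
  SimpleGraph.fromRel (fun u v => 0 < M u v)

/-- The support `|Z|` of a cycle. -/
def supp {V : Type} (Z : V → ℤ) : Set V := {v | Z v ≠ 0}

/-- The dual graph induced on the support of a cycle. -/
def inducedOnSupp {V : Type} (M : Matrix V V ℤ) (Z : V → ℤ) :
    SimpleGraph (supp Z) :=
  (dualGraph M).induce (supp Z)

/-- The part `Z_c` of a cycle `Z` corresponding to a connected component `c`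
of the dual graph induced on the support of `Z`:  it agrees with `Z` on the
component and vanishes elsewhere. -/
def compCycle {V : Type} (M : Matrix V V ℤ) (Z : V → ℤ)
    (c : (inducedOnSupp M Z).ConnectedComponent) : V → ℤ := fun v =>
  if h : Z v ≠ 0 then
    (if (inducedOnSupp M Z).connectedComponentMk ⟨v, h⟩ = c then Z v else 0)
  else 0

/-- The sum `Σ_i F(Z_i)` of a quantity `F` over the connected components
`Z = Σ_i Z_i` of a cycle. -/
def sumComp {V : Type} [Fintype V] (M : Matrix V V ℤ)
    (F : (V → ℤ) → ℚ) (Z : V → ℤ) : ℚ :=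
  ∑ᶠ c : (inducedOnSupp M Z).ConnectedComponent, F (compCycle M Z c)

end

section Basic

variable {V : Type}

lemma toQ_zero : toQ (0 : V → ℤ) = 0 := by ext; simp [toQ]

lemma toQ_sum {ι : Type*} (s : Finset ι) (x : ι → V → ℤ) :
    toQ (∑ c ∈ s, x c) = ∑ c ∈ s, toQ (x c) := by
  ext v
  simp [toQ, Finset.sum_apply]

lemma dualGraph_adj {M : Matrix V V ℤ} (hsym : ∀ u v, M u v = M v u) (u v : V) :
    (dualGraph M).Adj u v ↔ u ≠ v ∧ 0 < M u v := by
  simp [dualGraph, SimpleGraph.fromRel_adj, hsym v u]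

/-- The reduced cycle `E_{|Z|}` on the support of `Z`. -/
def reducedCycle (Z : V → ℤ) : V → ℤ := fun v => if Z v = 0 then 0 else 1

lemma reducedCycle_zero : reducedCycle (0 : V → ℤ) = 0 := by
  ext; simp [reducedCycle]

end Basic

section Pairing

variable {V : Type} [Fintype V] (M : Matrix V V ℤ)

lemma pairQ_add_left (x y z : V → ℚ) : pairQ M (x + y) z = pairQ M x z + pairQ M y z := by
  simp only [pairQ, Pi.add_apply, add_mul, Finset.sum_add_distrib]

lemma pairQ_add_right (x y z : V → ℚ) : pairQ M x (y + z) = pairQ M x y + pairQ M x z := by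
  simp only [pairQ, Pi.add_apply, mul_add, Finset.sum_add_distrib]

lemma pairQ_neg_left (x y : V → ℚ) : pairQ M (-x) y = -pairQ M x y := by
  simp only [pairQ, Pi.neg_apply, neg_mul, Finset.sum_neg_distrib]

lemma pairQ_neg_right (x y : V → ℚ) : pairQ M x (-y) = -pairQ M x y := by
  simp only [pairQ, Pi.neg_apply, mul_neg, Finset.sum_neg_distrib]

lemma pairQ_zero_left (x : V → ℚ) : pairQ M 0 x = 0 := by simp [pairQ]

lemma pairQ_zero_right (x : V → ℚ) : pairQ M x 0 = 0 := by simp [pairQ]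

variable {M}

lemma pairQ_comm (hsym : ∀ u v, M u v = M v u) (x y : V → ℚ) : pairQ M x y = pairQ M y x := by
  unfold pairQ
  rw [Finset.sum_comm]
  refine Finset.sum_congr rfl fun u _ => Finset.sum_congr rfl fun v _ => ?_
  rw [hsym v u]
  ring

lemma pairQ_eq_sum_mul_pairQ_single [DecidableEq V] (x y : V → ℚ) :
    pairQ M x y = ∑ v, y v * pairQ M x (Pi.single v 1) := by
  unfold pairQ
  rw [Finset.sum_comm]
  refine Finset.sum_congr rfl fun v _ => ?_
  rw [Finset.mul_sum]
  refine Finset.sum_congr rfl fun u _ => ?_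
  simp only [Pi.single_apply, mul_ite, mul_one, mul_zero, Finset.sum_ite_eq', Finset.mem_univ,
    if_true]
  ring

lemma pairQ_eq_zero_of_forall {x y : V → ℚ} (h : ∀ u v, x u ≠ 0 → y v ≠ 0 → M u v = 0) :
    pairQ M x y = 0 := by
  refine Finset.sum_eq_zero fun u _ => Finset.sum_eq_zero fun v _ => ?_
  by_cases hu : x u = 0
  · simp [hu]
  by_cases hv : y v = 0
  · simp [hv]
  simp [h u v hu hv]

lemma chiQ_add (hsym : ∀ u v, M u v = M v u) (K x y : V → ℚ) :
    chiQ M K (x + y) = chiQ M K x + chiQ M K y - pairQ M x y := by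
  simp only [chiQ, sub_eq_add_neg, pairQ_add_left, pairQ_add_right, pairQ_neg_right,
    pairQ_comm hsym y x]
  ring

lemma chiQ_zero (K : V → ℚ) : chiQ M K 0 = 0 := by simp [chiQ, pairQ_zero_left]

/-- The adjunction formula expressing `χ` without the canonical cycle. -/
lemma chiQ_eq_of_adjunction [DecidableEq V] (hsym : ∀ u v, M u v = M v u) {K : V → ℚ}
    (hK : ∀ v, pairQ M K (Pi.single v 1) = (M v v : ℚ) + 2) (x : V → ℚ) :
    chiQ M K x = (∑ v, x v * ((M v v : ℚ) + 2) - pairQ M x x) / 2 := by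
  have h : pairQ M x K = ∑ v, x v * ((M v v : ℚ) + 2) := by
    rw [pairQ_comm hsym, pairQ_eq_sum_mul_pairQ_single]
    simp only [hK]
  rw [chiQ, sub_eq_add_neg, pairQ_add_right, pairQ_neg_right, h]
  ring

lemma even_sum_sum_sub_sum_diag {ι : Type*} (s : Finset ι) {a : ι → ι → ℤ}
    (ha : ∀ u v, a u v = a v u) :
    Even (∑ u ∈ s, ∑ v ∈ s, a u v - ∑ v ∈ s, a v v) := by
  induction s using Finset.induction_on with
  | empty => simp
  | insert i s hi ih =>
    obtain ⟨k, hk⟩ := ih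
    refine ⟨k + ∑ v ∈ s, a i v, ?_⟩
    simp only [Finset.sum_insert hi, Finset.sum_add_distrib]
    have : ∑ u ∈ s, a u i = ∑ v ∈ s, a i v := Finset.sum_congr rfl fun u _ => ha u i
    linarith

lemma exists_int_chiQ_toQ [DecidableEq V] (hsym : ∀ u v, M u v = M v u) {K : V → ℚ}
    (hK : ∀ v, pairQ M K (Pi.single v 1) = (M v v : ℚ) + 2) (l : V → ℤ) :
    ∃ n : ℤ, chiQ M K (toQ l) = n := by
  obtain ⟨k, hk⟩ := even_sum_sum_sub_sum_diag Finset.univ (a := fun u v => l u * M u v * l v)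
    (fun u v => by rw [hsym u v]; ring)
  have h2 : Even (∑ v, (l v * (M v v + 2) - l v * M v v * l v)) := by
    refine Finset.even_sum _ fun v _ => ?_
    obtain ⟨m, hm⟩ := Int.even_mul_pred_self (l v)
    exact ⟨l v - m * M v v, by linear_combination -(M v v) * hm⟩
  obtain ⟨j, hj⟩ := h2
  rw [Finset.sum_sub_distrib] at hj
  refine ⟨j - k, ?_⟩
  rw [chiQ_eq_of_adjunction hsym hK]
  simp only [pairQ, toQ]
  have hk' := congrArg (Int.cast : ℤ → ℚ) hk
  have hj' := congrArg (Int.cast : ℤ → ℚ) hj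
  push_cast at hk' hj' ⊢
  linarith

lemma exists_int_pairQ_toQ [DecidableEq V] {l' : V → ℚ}
    (hl' : ∀ v, ∃ n : ℕ, pairQ M l' (Pi.single v 1) = n) (l : V → ℤ) :
    ∃ n : ℤ, pairQ M l' (toQ l) = n := by
  choose n hn using hl'
  refine ⟨∑ v, l v * n v, ?_⟩
  rw [pairQ_eq_sum_mul_pairQ_single]
  simp [hn, toQ]

end Pairing

section ReducedCycle

variable {V : Type} [Fintype V] {M : Matrix V V ℤ}

/-- `χ(E_{|Z|})` is the Euler characteristic of the dual graph induced on `|Z|`. -/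
lemma chiQ_reducedCycle [DecidableEq V] (hsym : ∀ u v, M u v = M v u)
    (hoff : ∀ u v : V, u ≠ v → M u v = 0 ∨ M u v = 1) {K : V → ℚ}
    (hK : ∀ v, pairQ M K (Pi.single v 1) = (M v v : ℚ) + 2) (Z : V → ℤ) :
    chiQ M K (toQ (reducedCycle Z)) =
      (Nat.card (supp Z) : ℚ) - Nat.card (inducedOnSupp M Z).edgeSet := by
  have hsum : ∀ f : V → ℚ, ∑ v, toQ (reducedCycle Z) v * f v = ∑ v : supp Z, f v := by
    intro f
    rw [← Finset.sum_subtype (Finset.univ.filter fun v => Z v ≠ 0) (by simp [supp]) f,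
      Finset.sum_filter]
    refine Finset.sum_congr rfl fun v _ => ?_
    by_cases h : Z v = 0 <;> simp [toQ, reducedCycle, h]
  have hpair : pairQ M (toQ (reducedCycle Z)) (toQ (reducedCycle Z)) =
      ∑ u : supp Z, ∑ v : supp Z, (M u v : ℚ) := by
    rw [← hsum fun u => ∑ v : supp Z, (M u v : ℚ)]
    refine Finset.sum_congr rfl fun u _ => ?_
    rw [← hsum fun v => (M u v : ℚ), Finset.mul_sum]
    exact Finset.sum_congr rfl fun v _ => by ring
  have hrow : ∀ u : supp Z, ∑ v : supp Z, (M u v : ℚ) =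
      (M u u : ℚ) + (inducedOnSupp M Z).degree u := by
    intro u
    rw [← SimpleGraph.card_neighborFinset_eq_degree, SimpleGraph.neighborFinset_eq_filter,
      Finset.card_filter, ← Finset.sum_ite_eq Finset.univ u (fun v => (M u v : ℚ)) |>.trans
        (if_pos (Finset.mem_univ _))]
    push_cast
    rw [← Finset.sum_add_distrib]
    refine Finset.sum_congr rfl fun v _ => ?_
    have hadj : (inducedOnSupp M Z).Adj u v ↔ (u : V) ≠ v ∧ 0 < M u v := dualGraph_adj hsym _ _
    by_cases huv : u = v
    · subst huv; simp
    · have huv' : (u : V) ≠ v := fun h => huv (Subtype.ext h)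
      rcases hoff u v huv' with h | h <;> simp [hadj, h, huv, huv']
  have hdeg := congrArg (Nat.cast : ℕ → ℚ) (inducedOnSupp M Z).sum_degrees_eq_twice_card_edges
  have hedge : Nat.card (inducedOnSupp M Z).edgeSet = (inducedOnSupp M Z).edgeFinset.card := by
    rw [Nat.card_eq_fintype_card, SimpleGraph.edgeFinset_card]
  push_cast at hdeg
  rw [chiQ_eq_of_adjunction hsym hK, hsum fun v => (M v v : ℚ) + 2, hpair,
    Finset.sum_congr rfl fun u _ => hrow u, Finset.sum_add_distrib, Finset.sum_add_distrib, hdeg,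
    hedge]
  simp
  ring

lemma SimpleGraph.IsAcyclic.card_edgeSet_add_one_le {W : Type*} [Finite W] [Nonempty W]
    {G : SimpleGraph W} (h : G.IsAcyclic) : Nat.card G.edgeSet + 1 ≤ Nat.card W := by
  obtain ⟨T, hGT, -, hT⟩ :=
    SimpleGraph.connected_top.exists_isTree_le_of_le_of_isAcyclic le_top h
  rw [← (SimpleGraph.isTree_iff_connected_and_card.mp hT).2]
  exact Nat.add_le_add_right
    (Nat.card_mono (Set.toFinite _) (SimpleGraph.edgeSet_mono hGT)) 1

lemma one_le_chiQ_reducedCycle [DecidableEq V] (hsym : ∀ u v, M u v = M v u)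
    (hoff : ∀ u v : V, u ≠ v → M u v = 0 ∨ M u v = 1) (hacyc : (dualGraph M).IsAcyclic)
    {K : V → ℚ} (hK : ∀ v, pairQ M K (Pi.single v 1) = (M v v : ℚ) + 2) {Z : V → ℤ}
    (hZ : Z ≠ 0) : 1 ≤ chiQ M K (toQ (reducedCycle Z)) := by
  obtain ⟨v, hv⟩ := Function.ne_iff.mp hZ
  have : Nonempty (supp Z) := ⟨⟨v, hv⟩⟩
  have h : Nat.card (inducedOnSupp M Z).edgeSet + 1 ≤ Nat.card (supp Z) :=
    (hacyc.induce (supp Z)).card_edgeSet_add_one_le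
  rw [chiQ_reducedCycle hsym hoff hK]
  have h' : (Nat.card (inducedOnSupp M Z).edgeSet + 1 : ℚ) ≤ Nat.card (supp Z) := by
    exact_mod_cast h
  linarith

lemma chiQ_reducedCycle_le_one [DecidableEq V] (hsym : ∀ u v, M u v = M v u)
    (hoff : ∀ u v : V, u ≠ v → M u v = 0 ∨ M u v = 1)
    {K : V → ℚ} (hK : ∀ v, pairQ M K (Pi.single v 1) = (M v v : ℚ) + 2) {Z : V → ℤ}
    (hZ : (inducedOnSupp M Z).Connected) : chiQ M K (toQ (reducedCycle Z)) ≤ 1 := by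
  have h := hZ.card_vert_le_card_edgeSet_add_one
  rw [chiQ_reducedCycle hsym hoff hK]
  have h' : (Nat.card (supp Z) : ℚ) ≤ Nat.card (inducedOnSupp M Z).edgeSet + 1 := by
    exact_mod_cast h
  linarith

end ReducedCycle

section Components

variable {V : Type} {M : Matrix V V ℤ} {W : V → ℤ}

lemma compCycle_ne_zero_iff (c : (inducedOnSupp M W).ConnectedComponent) (v : V) :
    compCycle M W c v ≠ 0 ↔
      ∃ h : W v ≠ 0, (inducedOnSupp M W).connectedComponentMk ⟨v, h⟩ = c := by
  unfold compCycle
  by_cases h : W v ≠ 0 <;> simp [h]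

lemma compCycle_nonneg (hW : 0 ≤ W) (c : (inducedOnSupp M W).ConnectedComponent) :
    0 ≤ compCycle M W c := by
  intro v
  have := hW v
  unfold compCycle
  split_ifs <;> simp_all

lemma compCycle_ne_zero (c : (inducedOnSupp M W).ConnectedComponent) : compCycle M W c ≠ 0 := by
  induction c using SimpleGraph.ConnectedComponent.ind with
  | h v => exact Function.ne_iff.mpr ⟨v, (compCycle_ne_zero_iff _ _).mpr ⟨v.2, rfl⟩⟩

lemma sum_compCycle [Fintype (inducedOnSupp M W).ConnectedComponent] :
    ∑ c : (inducedOnSupp M W).ConnectedComponent, compCycle M W c = W := by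
  ext v
  rw [Finset.sum_apply]
  by_cases h : W v ≠ 0
  · simp [compCycle, h]
  · simp [compCycle, not_not.mp h]

lemma eq_of_compCycle_ne_zero {c d : (inducedOnSupp M W).ConnectedComponent} {v : V}
    (hc : compCycle M W c v ≠ 0) (hd : compCycle M W d v ≠ 0) : c = d := by
  obtain ⟨h, rfl⟩ := (compCycle_ne_zero_iff _ _).mp hc
  obtain ⟨_, rfl⟩ := (compCycle_ne_zero_iff _ _).mp hd
  rfl

lemma eq_zero_of_compCycle_ne_zero (hsym : ∀ u v, M u v = M v u)
    (hoff : ∀ u v : V, u ≠ v → M u v = 0 ∨ M u v = 1)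
    {c d : (inducedOnSupp M W).ConnectedComponent} (hcd : c ≠ d) {u v : V}
    (hc : compCycle M W c u ≠ 0) (hd : compCycle M W d v ≠ 0) : M u v = 0 := by
  have huv : u ≠ v := by
    rintro rfl
    exact hcd (eq_of_compCycle_ne_zero hc hd)
  refine (hoff u v huv).resolve_right fun h1 => hcd ?_
  obtain ⟨hu, rfl⟩ := (compCycle_ne_zero_iff _ _).mp hc
  obtain ⟨hv, rfl⟩ := (compCycle_ne_zero_iff _ _).mp hd
  refine SimpleGraph.ConnectedComponent.sound (SimpleGraph.Adj.reachable ?_)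
  exact (dualGraph_adj hsym u v).mpr ⟨huv, by omega⟩

lemma connected_inducedOnSupp_compCycle (c : (inducedOnSupp M W).ConnectedComponent) :
    (inducedOnSupp M (compCycle M W c)).Connected := by
  let f : c.toSimpleGraph →g inducedOnSupp M (compCycle M W c) :=
    { toFun := fun v => ⟨v.1.1, (compCycle_ne_zero_iff _ _).mpr ⟨v.1.2, v.2⟩⟩
      map_rel' := fun h => h }
  refine c.connected_toSimpleGraph.map f ?_
  rintro ⟨v, hv⟩
  obtain ⟨h, hc⟩ := (compCycle_ne_zero_iff _ _).mp hv
  exact ⟨⟨⟨v, h⟩, hc⟩, rfl⟩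

lemma sumComp_eq_sum [Fintype V] [Fintype (inducedOnSupp M W).ConnectedComponent]
    (F : (V → ℤ) → ℚ) :
    sumComp M F W = ∑ c : (inducedOnSupp M W).ConnectedComponent, F (compCycle M W c) :=
  finsum_eq_sum_of_fintype _

lemma chiQ_sum_of_orthogonal [Fintype V] (hsym : ∀ u v, M u v = M v u) (K : V → ℚ) {ι : Type*}
    {x : ι → V → ℚ} (h : ∀ i j, i ≠ j → pairQ M (x i) (x j) = 0) (s : Finset ι) :
    chiQ M K (∑ i ∈ s, x i) = ∑ i ∈ s, chiQ M K (x i) := by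
  induction s using Finset.induction_on with
  | empty => simp [chiQ_zero]
  | insert i s hi ih =>
    have h0 : pairQ M (x i) (∑ j ∈ s, x j) = 0 := by
      simp only [pairQ, Finset.sum_apply]
      simp only [Finset.mul_sum]
      rw [Finset.sum_congr rfl fun u _ => Finset.sum_comm, Finset.sum_comm]
      exact Finset.sum_eq_zero fun j hj => h i j (ne_of_mem_of_not_mem hj hi).symm
    rw [Finset.sum_insert hi, Finset.sum_insert hi, chiQ_add hsym, ih, h0, sub_zero]

end Components

section Gain

variable {V : Type} [Fintype V] {M : Matrix V V ℤ}

/-- The topological expression `−(l',x) − χ(x) + χ(E_{|x|})`. -/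
def gain (M : Matrix V V ℤ) (K l' : V → ℚ) (x : V → ℤ) : ℚ :=
  -pairQ M l' (toQ x) - chiQ M K (toQ x) + chiQ M K (toQ (reducedCycle x))

lemma gain_zero (K l' : V → ℚ) : gain M K l' 0 = 0 := by
  simp [gain, reducedCycle_zero, toQ_zero, pairQ_zero_right, chiQ_zero]

/-- `gain` is additive over cycles supported on distinct components of `|W|`. -/
lemma gain_sum_of_support_compCycle (hsym : ∀ u v, M u v = M v u)
    (hoff : ∀ u v : V, u ≠ v → M u v = 0 ∨ M u v = 1) (K l' : V → ℚ) {W : V → ℤ}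
    [Fintype (inducedOnSupp M W).ConnectedComponent]
    {x : (inducedOnSupp M W).ConnectedComponent → V → ℤ}
    (hx : ∀ c v, x c v ≠ 0 → compCycle M W c v ≠ 0) :
    gain M K l' (∑ c, x c) = ∑ c, gain M K l' (x c) := by
  have horth : ∀ c d, c ≠ d → pairQ M (toQ (x c)) (toQ (x d)) = 0 := fun c d hcd =>
    pairQ_eq_zero_of_forall fun u v hu hv =>
      eq_zero_of_compCycle_ne_zero hsym hoff hcd (hx c u (by simpa [toQ] using hu))
        (hx d v (by simpa [toQ] using hv))
  have hred : ∀ c v, toQ (reducedCycle (x c)) v ≠ 0 → compCycle M W c v ≠ 0 := fun c v h =>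
    hx c v fun h0 => h (by simp [toQ, reducedCycle, h0])
  have horth' : ∀ c d, c ≠ d →
      pairQ M (toQ (reducedCycle (x c))) (toQ (reducedCycle (x d))) = 0 := fun c d hcd =>
    pairQ_eq_zero_of_forall fun u v hu hv =>
      eq_zero_of_compCycle_ne_zero hsym hoff hcd (hred c u hu) (hred d v hv)
  have hsum : reducedCycle (∑ c, x c) = ∑ c, reducedCycle (x c) := by
    ext v
    by_cases hv : ∃ c, x c v ≠ 0
    · obtain ⟨c, hc⟩ := hv
      have h0 : ∀ d, d ≠ c → x d v = 0 := fun d hd => by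
        by_contra h
        exact hd (eq_of_compCycle_ne_zero (hx d v h) (hx c v hc))
      have h1 : (∑ d, x d) v = x c v := by
        rw [Finset.sum_apply]
        exact Fintype.sum_eq_single c h0
      have h2 : (∑ d, reducedCycle (x d)) v = reducedCycle (x c) v := by
        rw [Finset.sum_apply]
        exact Fintype.sum_eq_single c fun d hd => by simp [reducedCycle, h0 d hd]
      rw [h2, reducedCycle, reducedCycle, h1]
    · push Not at hv
      simp [reducedCycle, hv]
  have hpair : pairQ M l' (∑ c, toQ (x c)) = ∑ c, pairQ M l' (toQ (x c)) :=
    map_sum (⟨⟨pairQ M l', pairQ_zero_right M l'⟩, pairQ_add_right M l'⟩ : (V → ℚ) →+ ℚ) _ _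
  simp only [gain]
  rw [hsum, toQ_sum, toQ_sum, chiQ_sum_of_orthogonal hsym K horth,
    chiQ_sum_of_orthogonal hsym K horth', hpair]
  simp only [Finset.sum_add_distrib, Finset.sum_sub_distrib, Finset.sum_neg_distrib]

end Gain

/-- Corollary 6.8.  If the dual graph is a tree with edge
multiplicities in `{0,1}` (rational homology sphere link), then
`t(Z,l') = max_{0≤Z₁≤Z} ( −(l',Z₁) − χ(Z₁) + χ(E_{|Z₁|}) )`, where
`E_{|Z₁|} = Σ_{v∈|Z₁|} E_v` (and the term for `Z₁ = 0` equals `0`). -/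
theorem stmt_8
    (V : Type) [Fintype V] [DecidableEq V] [Nonempty V]
    (M : Matrix V V ℤ)
    (hsym : ∀ u v, M u v = M v u)
    (hneg : ∀ x : V → ℚ, x ≠ 0 → pairQ M x x < 0)
    (hoff : ∀ u v : V, u ≠ v → M u v = 0 ∨ M u v = 1)
    (htree : (dualGraph M).IsTree)
    (ZK : V → ℚ)
    (hZK : ∀ v, pairQ M ZK (Pi.single v 1) = (M v v : ℚ) + 2)
    (l' : V → ℚ)
    (hl' : ∀ v, ∃ n : ℕ, pairQ M l' (Pi.single v 1) = n)
    (Z : V → ℤ) (hZ : ∀ v, 1 ≤ Z v)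
    -- `D` : the dominance defect
    (D : (V → ℤ) → ℚ)
    (hD0 : ∀ W : V → ℤ,
      (∀ l : V → ℤ, 0 < l → l ≤ W → chiQ M ZK (-l') < chiQ M ZK (-l' + toQ l)) →
      D W = 0)
    (hD1 : ∀ W : V → ℤ,
      (∃ l : V → ℤ, 0 < l ∧ l ≤ W ∧ chiQ M ZK (-l' + toQ l) ≤ chiQ M ZK (-l')) →
      D W = 1)
    -- `μ W = min_{0 ≤ l ≤ W} χ(−l' + l)`
    (μ : (V → ℤ) → ℚ)
    (hμ : ∀ W : V → ℤ, 0 ≤ W →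
      IsLeast {q : ℚ | ∃ l : V → ℤ, 0 ≤ l ∧ l ≤ W ∧
        q = chiQ M ZK (-l' + toQ l)} (μ W))
    -- `t = t(Z,l') = max_{0<Z''≤Z} Σ_i T(Z''_i,l')` with `T(W,l') = χ(−l') − μ W + D W`
    (t : ℚ)
    (ht : IsGreatest {q : ℚ | ∃ W : V → ℤ, 0 < W ∧ W ≤ Z ∧
      q = sumComp M (fun W' => chiQ M ZK (-l') - μ W' + D W') W} t) :
    IsGreatest {q : ℚ | ∃ Z₁ : V → ℤ, 0 ≤ Z₁ ∧ Z₁ ≤ Z ∧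
        q = -(pairQ M l' (toQ Z₁)) - chiQ M ZK (toQ Z₁) +
            chiQ M ZK (toQ (fun v => if Z₁ v = 0 then 0 else 1))} t := by
  have hchi : ∀ l : V → ℤ, chiQ M ZK (-l' + toQ l) =
      chiQ M ZK (-l') + (chiQ M ZK (toQ l) + pairQ M l' (toQ l)) := fun l => by
    rw [chiQ_add hsym, pairQ_neg_left]
    ring
  set T : (V → ℤ) → ℚ := fun W' => chiQ M ZK (-l') - μ W' + D W' with hT
  have hD : ∀ W, D W = 0 ∨ D W = 1 := fun W => by
    by_cases h : ∀ l : V → ℤ, 0 < l → l ≤ W → chiQ M ZK (-l') < chiQ M ZK (-l' + toQ l)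
    · exact Or.inl (hD0 W h)
    · push Not at h
      exact Or.inr (hD1 W h)
  have hT0 : ∀ W, 0 ≤ W → 0 ≤ T W := fun W hW => by
    have h := (hμ W hW).2 ⟨0, le_rfl, hW, rfl⟩
    rw [toQ_zero, add_zero] at h
    rcases hD W with h' | h' <;> (simp only [hT, h']; linarith)
  have hTlower : ∀ W l : V → ℤ, 0 < l → l ≤ W →
      1 - (chiQ M ZK (toQ l) + pairQ M l' (toQ l)) ≤ T W := fun W l hl hlW => by
    have hmin := (hμ W (hl.le.trans hlW)).2 ⟨l, hl.le, hlW, rfl⟩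
    obtain ⟨a, ha⟩ := exists_int_chiQ_toQ hsym hZK l
    obtain ⟨b, hb⟩ := exists_int_pairQ_toQ hl' l
    rcases le_or_gt (a + b) 0 with h | h
    · have h' : (a + b : ℚ) ≤ 0 := by exact_mod_cast h
      have hD' := hD1 W ⟨l, hl, hlW, by rw [hchi, ha, hb]; linarith⟩
      rw [hchi] at hmin
      simp only [hT, hD']
      linarith
    · have h' : (1 : ℚ) ≤ a + b := by exact_mod_cast h
      have := hT0 W (hl.le.trans hlW)
      rw [ha, hb]
      linarith
  have hTupper : ∀ W : V → ℤ, 0 ≤ W → ∃ l : V → ℤ, 0 ≤ l ∧ l ≤ W ∧ T W ≤ gain M ZK l' l := by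
    intro W hW
    have hpos : ∀ l : V → ℤ, 0 < l → T W ≤ 1 - (chiQ M ZK (toQ l) + pairQ M l' (toQ l)) →
        T W ≤ gain M ZK l' l := fun l hl h => by
      have := one_le_chiQ_reducedCycle hsym hoff htree.isAcyclic hZK hl.ne'
      unfold gain
      linarith
    obtain ⟨l, hl, hlW, hlμ⟩ := (hμ W hW).1
    have hTl : T W = D W - (chiQ M ZK (toQ l) + pairQ M l' (toQ l)) := by
      simp only [hT, hlμ, hchi]
      ring
    rcases hl.eq_or_lt with rfl | hl0
    · rw [toQ_zero, chiQ_zero, pairQ_zero_right] at hTl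
      by_cases h : ∀ l : V → ℤ, 0 < l → l ≤ W → chiQ M ZK (-l') < chiQ M ZK (-l' + toQ l)
      · refine ⟨0, le_rfl, hW, ?_⟩
        rw [gain_zero, hTl, hD0 W h]
        simp
      · push Not at h
        obtain ⟨m, hm, hmW, hle⟩ := h
        refine ⟨m, hm.le, hmW, hpos m hm ?_⟩
        rw [hTl, hD1 W ⟨m, hm, hmW, hle⟩]
        rw [hchi] at hle
        linarith
    · refine ⟨l, hl, hlW, hpos l hl0 ?_⟩
      rw [hTl]
      rcases hD W with h | h <;> linarith
  obtain ⟨⟨W, hW, hWZ, rfl⟩, htop⟩ := ht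
  have hgain : ∀ Z₁ : V → ℤ, 0 ≤ Z₁ → Z₁ ≤ Z → gain M ZK l' Z₁ ≤ sumComp M T W := by
    intro Z₁ h0 hZ₁
    rcases h0.eq_or_lt with rfl | hpos
    · rw [gain_zero, sumComp_eq_sum]
      exact Finset.sum_nonneg fun c _ => hT0 _ (compCycle_nonneg hW.le c)
    · refine le_trans ?_ (htop ⟨Z₁, hpos, hZ₁, rfl⟩)
      have hadd := gain_sum_of_support_compCycle hsym hoff ZK l' (W := Z₁)
        (x := compCycle M Z₁) fun _ _ h => h
      rw [sum_compCycle] at hadd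
      rw [hadd, sumComp_eq_sum]
      refine Finset.sum_le_sum fun c _ => ?_
      have hχ := chiQ_reducedCycle_le_one hsym hoff hZK (connected_inducedOnSupp_compCycle c)
      have hlow := hTlower (compCycle M Z₁ c) (compCycle M Z₁ c)
        ((compCycle_nonneg h0 c).lt_of_ne (compCycle_ne_zero c).symm) le_rfl
      unfold gain
      linarith
  constructor
  · choose l hl hlW hlT using fun c => hTupper (compCycle M W c) (compCycle_nonneg hW.le c)
    have hadd := gain_sum_of_support_compCycle hsym hoff ZK l' (x := l) fun c v h h0 =>
      h (le_antisymm (h0 ▸ hlW c v) (hl c v))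
    have hle : sumComp M T W ≤ gain M ZK l' (∑ c, l c) := by
      rw [sumComp_eq_sum, hadd]
      exact Finset.sum_le_sum fun c _ => hlT c
    have hl0 : 0 ≤ ∑ c, l c := Finset.sum_nonneg fun c _ => hl c
    have hlZ : ∑ c, l c ≤ Z :=
      ((Finset.sum_le_sum fun c _ => hlW c).trans_eq sum_compCycle).trans hWZ
    exact ⟨∑ c, l c, hl0, hlZ, le_antisymm hle (hgain _ hl0 hlZ)⟩
  · rintro _ ⟨Z₁, h0, hZ₁, rfl⟩
    exact hgain Z₁ h0 hZ₁
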